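/- Let (x_n) be generated by Algorithm 1.1 for a nonempty closed convex set Z ⊆ H and x₀ ∈ L²(Ω,ℱ,P;H), with each x_n square-integrable, and set 𝒳_n = σ(x₀,…,x_n). Then Σ_{n∈ℕ} E‖x_{n+1} − x_n‖² ≤ E‖proj_Z x₀ − x₀‖² < +∞, and P-almost surely Σ_{n∈ℕ} E[‖x_{n+1} − x_n‖² | 𝒳_n] < +∞. -/

import Mathlib

open MeasureTheory Filter RealInnerProductSpace Topology

/-- The half-space `H(x,y) = {z : ⟪z - y, x - y⟫ ≤ 0}`. -/
def halfSpace {H : Type*} [NormedAddCommGroup H] [InnerProductSpace ℝ H] (x y : H) : Set H :=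
  {z : H | ⟪z - y, x - y⟫ ≤ 0}

open scoped Classical in
/-- The outer set `O(x,y,z)`. -/
noncomputable def Oset {H : Type*} [NormedAddCommGroup H] [InnerProductSpace ℝ H]
    (x y z : H) : Set H :=
  if (halfSpace x y ∩ halfSpace y z).Nonempty then halfSpace x y ∩ halfSpace y z else {y}

/-- `q` is the metric projection of `x` onto `C`. -/
def IsProjPt {H : Type*} [NormedAddCommGroup H] [InnerProductSpace ℝ H]
    (C : Set H) (x q : H) : Prop :=
  q ∈ C ∧ ∀ w ∈ C, ‖x - q‖ ≤ ‖x - w‖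

theorem convex_halfSpace {H : Type*} [NormedAddCommGroup H] [InnerProductSpace ℝ H] (x y : H) :
    Convex ℝ (halfSpace x y) := by
  intro u hu v hv s t hs ht hst
  simp only [halfSpace, Set.mem_ofPred_eq] at *
  have h : s • u + t • v - y = s • (u - y) + t • (v - y) := by
    have hy : y = (s + t) • y := by rw [hst, one_smul]
    nth_rewrite 1 [hy]
    module
  rw [h, inner_add_left, real_inner_smul_left, real_inner_smul_left]
  nlinarith [mul_nonneg hs (neg_nonneg.2 hu), mul_nonneg ht (neg_nonneg.2 hv)]

/-- A convex set lies in the half-space bounded at the projection of a point. -/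
theorem IsProjPt.subset_halfSpace {H : Type*} [NormedAddCommGroup H] [InnerProductSpace ℝ H]
    {C : Set H} (hC : Convex ℝ C) {x q : H} (h : IsProjPt C x q) : C ⊆ halfSpace x q := by
  intro w hw
  have : Nonempty C := ⟨⟨q, h.1⟩⟩
  have hmin : ‖x - q‖ = ⨅ w : C, ‖x - w‖ :=
    le_antisymm (le_ciInf fun w => h.2 w w.2)
      (ciInf_le ⟨0, Set.forall_mem_range.2 fun w => norm_nonneg _⟩ (⟨q, h.1⟩ : C))
  have := (norm_eq_iInf_iff_real_inner_le_zero hC h.1).1 hmin w hw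
  rwa [real_inner_comm] at this

theorem IsProjPt.norm_sub_eq_infDist {H : Type*} [NormedAddCommGroup H] [InnerProductSpace ℝ H]
    {C : Set H} {x q : H} (h : IsProjPt C x q) : ‖q - x‖ = Metric.infDist x C := by
  refine le_antisymm ((Metric.le_infDist ⟨q, h.1⟩).2 fun w hw => ?_) ?_
  · rw [dist_eq_norm, norm_sub_rev]
    exact h.2 w hw
  · rw [norm_sub_rev, ← dist_eq_norm]
    exact Metric.infDist_le_dist_of_mem h.1

theorem norm_sub_sq_add_le_of_mem_halfSpace {H : Type*} [NormedAddCommGroup H]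
    [InnerProductSpace ℝ H] {x y z : H} (h : z ∈ halfSpace x y) :
    ‖x - y‖ ^ 2 + ‖z - y‖ ^ 2 ≤ ‖x - z‖ ^ 2 := by
  have h' : ⟪z - y, x - y⟫ ≤ 0 := h
  have e : x - z = (x - y) - (z - y) := by abel
  rw [e, norm_sub_sq_real (x - y), real_inner_comm]
  linarith

/-- Relaxing the point `a` towards `x` enlarges the half-space. -/
theorem halfSpace_subset_halfSpace_relaxation {H : Type*} [NormedAddCommGroup H]
    [InnerProductSpace ℝ H] (x a : H) {t : ℝ} (ht : t ∈ Set.Ioc (0 : ℝ) 1) :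
    halfSpace x a ⊆ halfSpace x (x + t • (a - x)) := by
  intro z hz
  have hz' : ⟪z - a, x - a⟫ ≤ 0 := hz
  have e₁ : z - (x + t • (a - x)) = (z - a) - (1 - t) • (x - a) := by module
  have e₂ : x - (x + t • (a - x)) = t • (x - a) := by module
  change ⟪z - (x + t • (a - x)), x - (x + t • (a - x))⟫ ≤ 0
  rw [e₁, e₂, real_inner_smul_right, inner_sub_left, real_inner_smul_left,
    real_inner_self_eq_norm_sq]
  have := mul_nonneg (sub_nonneg.2 ht.2) (sq_nonneg ‖x - a‖)
  exact mul_nonpos_of_nonneg_of_nonpos ht.1.le (by linarith)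

theorem Oset_eq_inter_of_subset {H : Type*} [NormedAddCommGroup H] [InnerProductSpace ℝ H]
    {Z : Set H} (hZ : Z.Nonempty) {x y z : H} (h₁ : Z ⊆ halfSpace x y) (h₂ : Z ⊆ halfSpace y z) :
    Oset x y z = halfSpace x y ∩ halfSpace y z :=
  if_pos (hZ.mono (Set.subset_inter h₁ h₂))

/-- Deterministic Haugazeau sequences: `Z` stays in the half-spaces anchored at `x 0`. -/
theorem haugazeau_subset_halfSpace {H : Type*} [NormedAddCommGroup H] [InnerProductSpace ℝ H]
    {Z : Set H} (hZ : Z.Nonempty) {x r : ℕ → H} (hr : ∀ n, Z ⊆ halfSpace (x n) (r n))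
    (hx : ∀ n, IsProjPt (Oset (x 0) (x n) (r n)) (x 0) (x (n + 1))) (n : ℕ) :
    Z ⊆ halfSpace (x 0) (x n) := by
  induction n with
  | zero => intro z _; simp [halfSpace]
  | succ n ih =>
    have h := hx n
    rw [Oset_eq_inter_of_subset hZ ih (hr n)] at h
    exact (Set.subset_inter ih (hr n)).trans
      (h.subset_halfSpace ((convex_halfSpace _ _).inter (convex_halfSpace _ _)))

theorem haugazeau_sum_sq_le {H : Type*} [NormedAddCommGroup H] [InnerProductSpace ℝ H]
    {Z : Set H} {x r : ℕ → H} (hr : ∀ n, Z ⊆ halfSpace (x n) (r n))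
    (hx : ∀ n, IsProjPt (Oset (x 0) (x n) (r n)) (x 0) (x (n + 1))) {z : H} (hz : z ∈ Z) (N : ℕ) :
    ∑ n ∈ Finset.range N, ‖x (n + 1) - x n‖ ^ 2 ≤ ‖z - x 0‖ ^ 2 := by
  have hZ : Z.Nonempty := ⟨z, hz⟩
  have hsub := haugazeau_subset_halfSpace hZ hr hx
  have hstep (n : ℕ) : ‖x (n + 1) - x n‖ ^ 2 ≤ ‖x 0 - x (n + 1)‖ ^ 2 - ‖x 0 - x n‖ ^ 2 := by
    have h := (hx n).1
    rw [Oset_eq_inter_of_subset hZ (hsub n) (hr n)] at h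
    linarith [norm_sub_sq_add_le_of_mem_halfSpace h.1]
  calc ∑ n ∈ Finset.range N, ‖x (n + 1) - x n‖ ^ 2
      ≤ ∑ n ∈ Finset.range N, (‖x 0 - x (n + 1)‖ ^ 2 - ‖x 0 - x n‖ ^ 2) :=
        Finset.sum_le_sum fun n _ => hstep n
    _ = ‖x 0 - x N‖ ^ 2 := by rw [Finset.sum_range_sub fun n => ‖x 0 - x n‖ ^ 2]; simp
    _ ≤ ‖z - x 0‖ ^ 2 := by
        rw [norm_sub_rev z]
        linarith [norm_sub_sq_add_le_of_mem_halfSpace (hsub N hz), sq_nonneg ‖z - x N‖]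

/-- If the integrals of the norms are summable, then the functions are almost everywhere
summable. -/
theorem ae_summable_of_summable_integral_norm {Ω ι E : Type*} [MeasurableSpace Ω] {μ : Measure Ω}
    [Countable ι] [NormedAddCommGroup E] [CompleteSpace E] {f : ι → Ω → E}
    (hf : ∀ i, Integrable (f i) μ) (hsum : Summable fun i => ∫ ω, ‖f i ω‖ ∂μ) :
    ∀ᵐ ω ∂μ, Summable fun i => f i ω := by
  have hmeas (i : ι) : AEMeasurable (fun ω => ‖f i ω‖ₑ) μ := (hf i).1.enorm
  have hfin : ∫⁻ ω, ∑' i, ‖f i ω‖ₑ ∂μ ≠ ⊤ := by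
    rw [lintegral_tsum hmeas]
    simp_rw [← ofReal_integral_norm_eq_lintegral_enorm (hf _)]
    exact hsum.tsum_ofReal_ne_top
  filter_upwards [ae_lt_top' (AEMeasurable.tsum hmeas) hfin] with ω hω
  refine Summable.of_norm ?_
  have := ENNReal.summable_toReal hω.ne
  simpa using this

/-- Theorem 3.1(v): summability of the expected and conditionally expected squared increments. -/
theorem haugazeau_summable_increments
    {Ω : Type*} [MeasurableSpace Ω] (μ : Measure Ω)
    [IsProbabilityMeasure μ] [μ.IsComplete]
    {H : Type*} [NormedAddCommGroup H] [InnerProductSpace ℝ H] [CompleteSpace H]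
    [SecondCountableTopology H] [MeasurableSpace H] [BorelSpace H]
    (Z : Set H) (hZne : Z.Nonempty) (hZcl : IsClosed Z) (hZconv : Convex ℝ Z)
    (x a r : ℕ → Ω → H) (lam : ℕ → Ω → ℝ)
    (hx0 : MemLp (x 0) 2 μ)
    (hxL2 : ∀ n, MemLp (x n) 2 μ)
    (ha : ∀ n, MemLp (a n) 2 μ)
    (haZ : ∀ n, ∀ᵐ ω ∂μ, Z ⊆ halfSpace (x n ω) (a n ω))
    (hlam_meas : ∀ n, Measurable (lam n))
    (hlam : ∀ n ω, lam n ω ∈ Set.Ioc (0 : ℝ) 1)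
    (hr : ∀ n ω, r n ω = x n ω + lam n ω • (a n ω - x n ω))
    (hxsucc : ∀ n ω, IsProjPt (Oset (x 0 ω) (x n ω) (r n ω)) (x 0 ω) (x (n + 1) ω))
    (pZ : H → H) (hpZ : ∀ v : H, IsProjPt Z v (pZ v))
    (𝒳 : ℕ → MeasurableSpace Ω)
    (h𝒳 : ∀ n, 𝒳 n = ⨆ i : Fin (n + 1), MeasurableSpace.comap (x i) inferInstance) :
    Summable (fun n => ∫ ω, ‖x (n + 1) ω - x n ω‖ ^ 2 ∂μ) ∧
    (∑' n, ∫ ω, ‖x (n + 1) ω - x n ω‖ ^ 2 ∂μ) ≤ ∫ ω, ‖pZ (x 0 ω) - x 0 ω‖ ^ 2 ∂μ ∧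
    Integrable (fun ω => ‖pZ (x 0 ω) - x 0 ω‖ ^ 2) μ ∧
    ∀ᵐ ω ∂μ, Summable fun n =>
      (μ[(fun ω' => ‖x (n + 1) ω' - x n ω'‖ ^ 2) | 𝒳 n]) ω := by
  have hsq (n : ℕ) : Integrable (fun ω => ‖x (n + 1) ω - x n ω‖ ^ 2) μ :=
    ((hxL2 (n + 1)).sub (hxL2 n)).integrable_norm_pow two_ne_zero
  have hproj : Integrable (fun ω => ‖pZ (x 0 ω) - x 0 ω‖ ^ 2) μ := by
    obtain ⟨z, hz⟩ := hZne
    have hdom : Integrable (fun ω => ‖x 0 ω - z‖ ^ 2) μ :=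
      (hx0.sub (memLp_const z)).integrable_norm_pow two_ne_zero
    refine hdom.mono' ?_ (ae_of_all _ fun ω => ?_)
    · simp_rw [(hpZ _).norm_sub_eq_infDist]
      exact ((Metric.continuous_infDist_pt Z).pow 2).comp_aestronglyMeasurable hx0.1
    · rw [norm_pow, norm_norm, norm_sub_rev]
      gcongr
      exact (hpZ _).2 z hz
  have hpath : ∀ᵐ ω ∂μ, ∀ N, ∑ n ∈ Finset.range N, ‖x (n + 1) ω - x n ω‖ ^ 2
      ≤ ‖pZ (x 0 ω) - x 0 ω‖ ^ 2 := by
    filter_upwards [ae_all_iff.2 haZ] with ω hω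
    refine haugazeau_sum_sq_le (x := fun n => x n ω) (r := fun n => r n ω) (fun n => ?_)
      (fun n => hxsucc n ω) (hpZ _).1
    rw [hr n ω]
    exact (hω n).trans (halfSpace_subset_halfSpace_relaxation _ _ (hlam n ω))
  have hnonneg (n : ℕ) : 0 ≤ ∫ ω, ‖x (n + 1) ω - x n ω‖ ^ 2 ∂μ :=
    integral_nonneg fun ω => sq_nonneg _
  have hpartial (N : ℕ) : ∑ n ∈ Finset.range N, ∫ ω, ‖x (n + 1) ω - x n ω‖ ^ 2 ∂μ
      ≤ ∫ ω, ‖pZ (x 0 ω) - x 0 ω‖ ^ 2 ∂μ := by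
    rw [← integral_finsetSum _ fun n _ => hsq n]
    exact integral_mono_ae (integrable_finsetSum _ fun n _ => hsq n) hproj
      (hpath.mono fun ω hω => hω N)
  have hsum := summable_of_sum_range_le hnonneg hpartial
  refine ⟨hsum, Real.tsum_le_of_sum_range_le hnonneg hpartial, hproj, ?_⟩
  have hle (n : ℕ) : 𝒳 n ≤ (inferInstance : MeasurableSpace Ω) := by
    rw [h𝒳 n]
    exact iSup_le fun i =>
      (hxL2 i).1.aemeasurable.nullMeasurable.measurable_of_complete.comap_le
  refine ae_summable_of_summable_integral_norm (fun n => integrable_condExp) ?_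
  refine hsum.congr fun n => ?_
  rw [← integral_condExp (hle n)]
  refine integral_congr_ae ?_
  filter_upwards [condExp_nonneg (m := 𝒳 n) (μ := μ)
    (ae_of_all _ fun ω => sq_nonneg ‖x (n + 1) ω - x n ω‖)] with ω hω
  exact (Real.norm_of_nonneg hω).symm
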